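/- arXiv:2007.04214 — 2 statements merged into one kernel-verified Lean document; each statement's English description precedes it below -/
import Mathlib

section
/- Let E be a finite set with |E| = n, let A* ⊆ E with |A*| = k where 1 ≤ k ≤ n, and let ε be a real number with 0 < ε ≤ 1. If m is a natural number with m ≤ n and (m : ℝ) ≥ (n/k) · log(1/ε), then the number of m-element subsets S of E with S ∩ A* = ∅ is at most ε times the total number of m-element subsets of E; equivalently, a uniformly random m-element subset R of E satisfies Pr[R ∩ A* ≠ ∅] ≥ 1 − ε. -/
/-- Cross-multiplied form of `C(a, m) / C(n, m) ≤ (a / n) ^ m` for `a ≤ n`. -/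
theorem Nat.choose_mul_pow_le_pow_mul_choose {a n : ℕ} (h : a ≤ n) (m : ℕ) :
    a.choose m * n ^ m ≤ a ^ m * n.choose m := by
  induction m with
  | zero => simp
  | succ m ih =>
    have step : (a - m) * n ≤ a * (n - m) := by
      rw [Nat.sub_mul, Nat.mul_sub, mul_comm a m]
      exact Nat.sub_le_sub_left (Nat.mul_le_mul_left m h) _
    refine Nat.le_of_mul_le_mul_right ?_ m.succ_pos
    calc a.choose (m + 1) * n ^ (m + 1) * (m + 1)
        = a.choose (m + 1) * (m + 1) * n ^ (m + 1) := by ring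
      _ = (a.choose m * n ^ m) * ((a - m) * n) := by rw [Nat.choose_succ_right_eq]; ring
      _ ≤ (a ^ m * n.choose m) * (a * (n - m)) := Nat.mul_le_mul ih step
      _ = a ^ (m + 1) * (n.choose m * (n - m)) := by ring
      _ = a ^ (m + 1) * n.choose (m + 1) * (m + 1) := by rw [← Nat.choose_succ_right_eq]; ring

/-- The `m`-subsets of `E` disjoint from `A` are the `m`-subsets of `E \ A`. -/
theorem Finset.filter_inter_eq_empty_powersetCard {α : Type*} [DecidableEq α]
    (E A : Finset α) (m : ℕ) :
    (E.powersetCard m).filter (fun S => S ∩ A = ∅) = (E \ A).powersetCard m := by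
  ext S
  simp only [Finset.mem_filter, Finset.mem_powersetCard, Finset.subset_sdiff,
    Finset.disjoint_iff_inter_eq_empty]
  tauto

/-- If `m ≥ (n / k) log (1 / ε)`, then `(1 - k / n) ^ m ≤ ε`. -/
theorem Real.one_sub_div_pow_le_of_log_le {n k m : ℕ} {ε : ℝ} (hk : 1 ≤ k) (hkn : k ≤ n)
    (hε : 0 < ε) (hm : (n : ℝ) / k * Real.log (1 / ε) ≤ m) :
    (1 - (k : ℝ) / n) ^ m ≤ ε := by
  have hk0 : (0 : ℝ) < k := by exact_mod_cast hk
  have hn0 : (0 : ℝ) < n := by exact_mod_cast hk.trans hkn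
  have hlog : -(m * ((k : ℝ) / n)) ≤ Real.log ε := by
    have := mul_le_mul_of_nonneg_right hm (div_pos hk0 hn0).le
    rw [one_div, Real.log_inv] at this
    have e : (n : ℝ) / k * -Real.log ε * (k / n) = -Real.log ε := by field_simp
    linarith
  calc (1 - (k : ℝ) / n) ^ m
      ≤ Real.exp (-((k : ℝ) / n)) ^ m := by
        gcongr
        · rw [sub_nonneg, div_le_one hn0]
          exact_mod_cast hkn
        · exact Real.one_sub_le_exp_neg _
    _ = Real.exp (-(m * ((k : ℝ) / n))) := by rw [← Real.exp_nat_mul, mul_neg]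
    _ ≤ ε := (Real.le_log_iff_exp_le hε).mp hlog

open Finset in
/-- Lemma 1 (counting form): if `|E| = n`, `A ⊆ E` with `|A| = k`, `1 ≤ k ≤ n`,
`0 < ε ≤ 1`, `m ≤ n` and `(m : ℝ) ≥ (n/k) · log(1/ε)`, then the number of
`m`-element subsets `S` of `E` with `S ∩ A = ∅` is at most `ε` times the total
number of `m`-element subsets of `E`. -/
theorem sampled_set_hits_best_set {α : Type*} [DecidableEq α]
    (E A : Finset α) (n k m : ℕ) (ε : ℝ)
    (hE : E.card = n) (hAE : A ⊆ E) (hA : A.card = k)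
    (hk1 : 1 ≤ k) (hkn : k ≤ n)
    (hε0 : 0 < ε) (hε1 : ε ≤ 1)
    (hmn : m ≤ n) (hm : (m : ℝ) ≥ ((n : ℝ) / (k : ℝ)) * Real.log (1 / ε)) :
    (((E.powersetCard m).filter (fun S => S ∩ A = ∅)).card : ℝ)
      ≤ ε * ((E.powersetCard m).card : ℝ) := by
  have hn0 : (0 : ℝ) < n := by exact_mod_cast hk1.trans hkn
  rw [filter_inter_eq_empty_powersetCard, card_powersetCard, card_powersetCard,
    card_sdiff_of_subset hAE, hE, hA]
  have hchoose : ((n - k).choose m : ℝ) * (n : ℝ) ^ m ≤ ((n : ℝ) - k) ^ m * n.choose m := by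
    rw [← Nat.cast_sub hkn]
    exact_mod_cast Nat.choose_mul_pow_le_pow_mul_choose (n.sub_le k) m
  calc ((n - k).choose m : ℝ)
      ≤ ((n : ℝ) - k) ^ m * n.choose m / (n : ℝ) ^ m := (le_div_iff₀ (by positivity)).mpr hchoose
    _ = (1 - (k : ℝ) / n) ^ m * n.choose m := by
        rw [one_sub_div hn0.ne', div_pow]
        ring
    _ ≤ ε * n.choose m := by
        gcongr
        exact Real.one_sub_div_pow_le_of_log_le hk1 hkn hε0 hm
end

section
/- Let E be a finite set, let w : E → ℝ be a nonnegative weight function, let A* ⊆ E be a subset with |A*| = k ≥ 1, and let m be a natural number with 1 ≤ m ≤ |E|. Then the sum, over all m-element subsets S of E, of max_{e ∈ S} w(e) is at least (1/k) · (Σ_{e ∈ A*} w(e)) · N, where N is the number of m-element subsets S of E with S ∩ A* ≠ ∅. Equivalently, for a uniformly random m-element subset R of E, E[max_{e ∈ R} w(e)] ≥ (1/k) · Pr[R ∩ A* ≠ ∅] · Σ_{e ∈ A*} w(e). -/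
section

open Finset

/-- Transposing two elements of a finset leaves the finset unchanged. -/
theorem Finset.map_swap_eq_self {α : Type*} [DecidableEq α] {s : Finset α} {a b : α}
    (ha : a ∈ s) (hb : b ∈ s) : s.map (Equiv.swap a b).toEmbedding = s := by
  refine eq_of_subset_of_card_le (fun x hx => ?_) (by simp)
  obtain ⟨y, hy, rfl⟩ := mem_map.mp hx
  rw [Equiv.coe_toEmbedding, Equiv.swap_apply_def]
  split_ifs <;> assumption

/-- If every `m`-subset `S` of `E` spreads a unit mass uniformly over `S ∩ A`, then all elements
of `A` receive the same total mass. -/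
theorem sum_inv_card_inter_eq {α : Type*} [DecidableEq α] {E A : Finset α} (hAE : A ⊆ E) (m : ℕ)
    {a b : α} (ha : a ∈ A) (hb : b ∈ A) :
    ∑ S ∈ E.powersetCard m, (if a ∈ S then (#(S ∩ A) : ℝ)⁻¹ else 0)
      = ∑ S ∈ E.powersetCard m, (if b ∈ S then (#(S ∩ A) : ℝ)⁻¹ else 0) := by
  have hmaps : ∀ S ∈ E.powersetCard m,
      S.map (Equiv.swap a b).toEmbedding ∈ E.powersetCard m := fun S hS => by
    rw [mem_powersetCard] at hS ⊢
    refine ⟨?_, by rw [card_map, hS.2]⟩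
    rw [← map_swap_eq_self (hAE ha) (hAE hb)]
    exact map_subset_map.mpr hS.1
  have hinv : ∀ S : Finset α,
      (S.map (Equiv.swap a b).toEmbedding).map (Equiv.swap a b).toEmbedding = S := fun S => by
    ext x
    simp [mem_map_equiv]
  refine sum_nbij' (fun S => S.map (Equiv.swap a b).toEmbedding)
    (fun S => S.map (Equiv.swap a b).toEmbedding) hmaps hmaps
    (fun S _ => hinv S) (fun S _ => hinv S) fun S _ => ?_
  have hcard : #(S.map (Equiv.swap a b).toEmbedding ∩ A) = #(S ∩ A) := by
    conv_lhs => rw [← map_swap_eq_self ha hb, ← map_inter, card_map]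
  simp only [hcard, mem_map_equiv, Equiv.symm_swap, Equiv.swap_apply_right]

/-- The unit masses carried by the `m`-subsets meeting `A` add up to the number of such subsets. -/
theorem sum_sum_inv_card_inter {α : Type*} [DecidableEq α] (E A : Finset α) (m : ℕ) :
    ∑ a ∈ A, ∑ S ∈ E.powersetCard m, (if a ∈ S then (#(S ∩ A) : ℝ)⁻¹ else 0)
      = #{S ∈ E.powersetCard m | S ∩ A ≠ ∅} := by
  rw [sum_comm, card_filter, Nat.cast_sum]
  refine sum_congr rfl fun S _ => ?_
  rw [← sum_filter, filter_mem_eq_inter, sum_const, nsmul_eq_mul, inter_comm A S]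
  by_cases h : S ∩ A = ∅
  · simp [h]
  · have : (#(S ∩ A) : ℝ) ≠ 0 := by simpa using h
    simp [h, this]

end

open Finset in
/-- Per-round symmetry bound: for a nonnegative weight `w`, a subset `A ⊆ E` with
`|A| = k ≥ 1`, and `1 ≤ m ≤ |E|`, the sum over all `m`-element subsets `S` of `E`
of `max_{e ∈ S} w e` is at least `(1/k) · (Σ_{e ∈ A} w e) · N`, where `N` is the
number of `m`-element subsets of `E` meeting `A`. -/
theorem sum_max_ge_hit_count_mul_avg {α : Type*} [DecidableEq α]
    (E A : Finset α) (w : α → ℝ) (k m : ℕ)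
    (hw : ∀ e, 0 ≤ w e) (hAE : A ⊆ E) (hA : A.card = k) (hk1 : 1 ≤ k)
    (hm1 : 1 ≤ m) (hmE : m ≤ E.card) :
    ((1 : ℝ) / (k : ℝ)) * (∑ e ∈ A, w e)
        * (((E.powersetCard m).filter (fun S => S ∩ A ≠ ∅)).card : ℝ)
      ≤ ∑ S ∈ (E.powersetCard m).attach,
          S.1.sup' (Finset.card_pos.mp (by
            have h := (Finset.mem_powersetCard.mp S.2).2
            omega)) w := by
  have hsup : ∀ S : (E.powersetCard m : Finset (Finset α)), ∀ hS : S.1.Nonempty,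
      ∑ a ∈ A, w a * (if a ∈ S.1 then (#(S.1 ∩ A) : ℝ)⁻¹ else 0) ≤ S.1.sup' hS w := by
    intro S hS
    obtain ⟨x, hx⟩ := hS
    simp only [mul_ite, mul_zero]
    rw [← sum_filter, filter_mem_eq_inter, inter_comm A, ← sum_mul, ← div_eq_mul_inv]
    refine div_le_of_le_mul₀ (Nat.cast_nonneg _) ((hw x).trans (le_sup' w hx)) ?_
    rw [mul_comm, ← nsmul_eq_mul]
    exact sum_le_card_nsmul _ _ _ fun a ha => le_sup' w (mem_of_mem_inter_left ha)
  refine le_trans (le_of_eq ?_) (sum_le_sum fun S _ => hsup S _)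
  rw [sum_attach (E.powersetCard m)
      (fun S => ∑ a ∈ A, w a * (if a ∈ S then (#(S ∩ A) : ℝ)⁻¹ else 0)),
    sum_comm, ← sum_sum_inv_card_inter]
  simp only [← mul_sum]
  obtain ⟨b, hb⟩ : A.Nonempty := card_pos.mp (by omega)
  have hk : (k : ℝ) ≠ 0 := by positivity
  rw [sum_congr rfl fun a ha => sum_inv_card_inter_eq hAE m ha hb,
    sum_congr rfl fun a ha => congrArg (w a * ·) (sum_inv_card_inter_eq hAE m ha hb),
    sum_const, hA, nsmul_eq_mul, ← sum_mul]
  field_simp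
end
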